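/- arXiv:2509.22233 — 2 statements merged into one kernel-verified Lean document; each statement's English description precedes it below -/
import Mathlib

section
/- For any proper 3-coloring c of the grid graph on ℤ × ℤ, any two vertices u and v, and any two walks W₁ and W₂ both going from u to v in the grid graph, p(W₁) = p(W₂). -/
/-- Adjacency in the grid graph on ℤ × ℤ. -/
def gridAdj (u v : ℤ × ℤ) : Prop :=
  |u.1 - v.1| + |u.2 - v.2| = 1

/-- The potential of an edge, given a coloring `c`. -/
def pot (c : ℤ × ℤ → ℤ) (u v : ℤ × ℤ) : ℤ :=
  if c u ≠ 3 ∧ c v ≠ 3 then c u - c v else 0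

theorem Int.exists_primitive (f : ℤ → ℤ) :
    ∃ F : ℤ → ℤ, F 0 = 0 ∧ ∀ n, F (n + 1) = F n + f n := by
  refine ⟨fun n => ∑ i ∈ Finset.range n.toNat, f i -
    ∑ i ∈ Finset.range (-n).toNat, f (-1 - i), by simp, fun n => ?_⟩
  rcases le_or_gt 0 n with hn | hn
  · have h₁ : (n + 1).toNat = n.toNat + 1 := by omega
    have h₂ : (-(n + 1)).toNat = 0 := by omega
    have h₃ : (-n).toNat = 0 := by omega
    simp only [h₁, h₂, h₃, Finset.sum_range_succ, Int.toNat_of_nonneg hn, Finset.range_zero, Finset.sum_empty]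
    ring
  · have h₁ : (n + 1).toNat = 0 := by omega
    have h₂ : n.toNat = 0 := by omega
    have h₃ : (-n).toNat = (-(n + 1)).toNat + 1 := by omega
    have h₄ : -1 - (((-(n + 1)).toNat : ℕ) : ℤ) = n := by omega
    simp only [h₁, h₂, h₃, Finset.sum_range_succ, h₄, Finset.range_zero, Finset.sum_empty]
    ring

theorem pot_swap (c : ℤ × ℤ → ℤ) (u v : ℤ × ℤ) : pot c v u = -pot c u v := by
  unfold pot
  split_ifs <;> grind

theorem gridAdj_right (x y : ℤ) : gridAdj (x, y) (x + 1, y) := by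
  simp [gridAdj]

theorem gridAdj_up (x y : ℤ) : gridAdj (x, y) (x, y + 1) := by
  simp [gridAdj]

/-- The potential around a unit square vanishes. -/
theorem pot_square (c : ℤ × ℤ → ℤ)
    (hc_range : ∀ v, c v = 1 ∨ c v = 2 ∨ c v = 3)
    (hc_proper : ∀ u v, gridAdj u v → c u ≠ c v) (x y : ℤ) :
    pot c (x, y) (x + 1, y) + pot c (x + 1, y) (x + 1, y + 1) =
      pot c (x, y) (x, y + 1) + pot c (x, y + 1) (x + 1, y + 1) := by
  have h₁ := hc_proper _ _ (gridAdj_right x y)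
  have h₂ := hc_proper _ _ (gridAdj_up (x + 1) y)
  have h₃ := hc_proper _ _ (gridAdj_up x y)
  have h₄ := hc_proper _ _ (gridAdj_right x (y + 1))
  unfold pot
  rcases hc_range (x, y) with a | a | a <;>
  rcases hc_range (x + 1, y) with b | b | b <;>
  rcases hc_range (x, y + 1) with d | d | d <;>
  rcases hc_range (x + 1, y + 1) with e | e | e <;>
  simp_all

/-- The potential of a proper 3-coloring is the difference of a height function. -/
theorem exists_height (c : ℤ × ℤ → ℤ)
    (hc_range : ∀ v, c v = 1 ∨ c v = 2 ∨ c v = 3)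
    (hc_proper : ∀ u v, gridAdj u v → c u ≠ c v) :
    ∃ h : ℤ × ℤ → ℤ, ∀ u v, gridAdj u v → pot c u v = h v - h u := by
  obtain ⟨A, -, hA⟩ := Int.exists_primitive fun x => pot c (x, 0) (x + 1, 0)
  choose B hB₀ hB using fun x : ℤ => Int.exists_primitive fun y => pot c (x, y) (x, y + 1)
  have hright (x y : ℤ) : pot c (x, y) (x + 1, y) = A (x + 1) + B (x + 1) y - (A x + B x y) := by
    have hsq := pot_square c hc_range hc_proper x
    induction y using Int.induction_on with
    | zero => rw [hA, hB₀, hB₀]; ring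
    | succ k ih => linarith [hsq k, hB x k, hB (x + 1) k]
    | pred k ih =>
      have h₁ := hsq (-k - 1)
      have h₂ := hB x (-k - 1)
      have h₃ := hB (x + 1) (-k - 1)
      rw [sub_add_cancel] at h₁ h₂ h₃
      linarith
  refine ⟨fun v => A v.1 + B v.1 v.2, ?_⟩
  rintro ⟨a, b⟩ ⟨x, y⟩ h
  have hcases : (x = a + 1 ∧ y = b) ∨ (a = x + 1 ∧ b = y) ∨
      (x = a ∧ y = b + 1) ∨ (a = x ∧ b = y + 1) := by
    simp only [gridAdj] at h
    rcases abs_cases (a - x) with h₁ | h₁ <;> rcases abs_cases (b - y) with h₂ | h₂ <;> omega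
  rcases hcases with ⟨rfl, rfl⟩ | ⟨rfl, rfl⟩ | ⟨rfl, rfl⟩ | ⟨rfl, rfl⟩
  · exact hright _ _
  · rw [pot_swap, hright]; ring
  · simp only [hB]; ring
  · rw [pot_swap]; simp only [hB]; ring

/-- For any proper 3-coloring `c` of the grid graph on ℤ × ℤ, any two vertices `u`
and `v`, and any two walks `W₁` and `W₂` both going from `u` to `v` in the grid
graph, `p(W₁) = p(W₂)`. -/
theorem potential_walk_independent
    (c : ℤ × ℤ → ℤ)
    (hc_range : ∀ v, c v = 1 ∨ c v = 2 ∨ c v = 3)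
    (hc_proper : ∀ u v, gridAdj u v → c u ≠ c v)
    (u v : ℤ × ℤ)
    (m₁ m₂ : ℕ) (w₁ w₂ : ℕ → ℤ × ℤ)
    (hwalk₁ : ∀ i, i < m₁ → gridAdj (w₁ i) (w₁ (i + 1)))
    (hwalk₂ : ∀ i, i < m₂ → gridAdj (w₂ i) (w₂ (i + 1)))
    (hstart₁ : w₁ 0 = u) (hend₁ : w₁ m₁ = v)
    (hstart₂ : w₂ 0 = u) (hend₂ : w₂ m₂ = v) :
    ∑ i ∈ Finset.range m₁, pot c (w₁ i) (w₁ (i + 1)) =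
      ∑ i ∈ Finset.range m₂, pot c (w₂ i) (w₂ (i + 1)) := by
  obtain ⟨h, hh⟩ := exists_height c hc_range hc_proper
  have key (m : ℕ) (w : ℕ → ℤ × ℤ) (hw : ∀ i, i < m → gridAdj (w i) (w (i + 1))) :
      ∑ i ∈ Finset.range m, pot c (w i) (w (i + 1)) = h (w m) - h (w 0) := by
    rw [← Finset.sum_range_sub (fun i => h (w i))]
    exact Finset.sum_congr rfl fun i hi => hh _ _ (hw i (Finset.mem_range.mp hi))
  rw [key m₁ w₁ hwalk₁, key m₂ w₂ hwalk₂, hstart₁, hstart₂, hend₁, hend₂]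
end

section
/- Let b, k, ℓ be positive integers with ℓ² ≤ b, and let f : {0, 1, …, b} → ℤ satisfy f(0) = 0, |f(x+1) - f(x)| ≤ k for all x ∈ {0, 1, …, b-1}, and f(x+ℓ) - f(x) > 2k for all x ∈ {0, 1, …, b-ℓ}. Then f(x) > 0 for every integer x with ℓ² ≤ x ≤ b. (In particular, such an f cannot satisfy f(b) = 0.) -/
/-- A function whose unit steps on `{0,…,b}` are at least `-k` satisfies `f 0 - k * n ≤ f n`. -/
theorem sub_mul_le_of_neg_le_step {b k : ℤ} {f : ℤ → ℤ}
    (hstep : ∀ x, 0 ≤ x → x ≤ b - 1 → -k ≤ f (x + 1) - f x) (n : ℕ) (hn : (n : ℤ) ≤ b) :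
    f 0 - k * n ≤ f n := by
  induction n with
  | zero => simp
  | succ n ih =>
    push_cast at hn ⊢
    linarith [ih (by lia), hstep n (by lia) (by lia)]

/-- A function that grows by at least `c` over every window of length `ℓ` in `{0,…,b}` grows by
at least `c * q` over `q` consecutive windows. -/
theorem add_mul_le_of_le_window {b c ℓ r : ℤ} {f : ℤ → ℤ} (hℓ : 0 ≤ ℓ) (hr : 0 ≤ r)
    (hgrow : ∀ x, 0 ≤ x → x ≤ b - ℓ → c ≤ f (x + ℓ) - f x)
    (q : ℕ) (hq : r + ℓ * q ≤ b) : f r + c * q ≤ f (r + ℓ * q) := by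
  induction q with
  | zero => simp
  | succ q ih =>
    push_cast at hq ⊢
    have hg := hgrow (r + ℓ * q) (by positivity) (by linarith)
    rw [show r + ℓ * q + ℓ = r + ℓ * (q + 1) by ring] at hg
    linarith [ih (by linarith)]

/-- If `f : {0,…,b} → ℤ` starts at `0`, changes by at most `k` at each step, and
increases by more than `2k` over every window of length `ℓ`, then `f x > 0` for all
`x` with `ℓ² ≤ x ≤ b`. -/
theorem increment_forces_positive
    (b k ℓ : ℤ) (hb : 0 < b) (hk : 0 < k) (hℓ : 0 < ℓ) (hℓsq : ℓ ^ 2 ≤ b)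
    (f : ℤ → ℤ)
    (h0 : f 0 = 0)
    (hstep : ∀ x, 0 ≤ x → x ≤ b - 1 → |f (x + 1) - f x| ≤ k)
    (hgrow : ∀ x, 0 ≤ x → x ≤ b - ℓ → 2 * k < f (x + ℓ) - f x) :
    ∀ x, ℓ ^ 2 ≤ x → x ≤ b → 0 < f x := by
  intro x hx hxb
  have hr0 : 0 ≤ x % ℓ := Int.emod_nonneg x hℓ.ne'
  have hrℓ : x % ℓ < ℓ := Int.emod_lt_of_pos x hℓ
  have hqℓ : ℓ ≤ x / ℓ := (Int.le_ediv_iff_mul_le hℓ).2 (by rwa [← sq])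
  have hx_eq : x % ℓ + ℓ * (x / ℓ) = x := Int.emod_add_mul_ediv x ℓ
  obtain ⟨r, hr⟩ := Int.eq_ofNat_of_zero_le hr0
  obtain ⟨q, hq⟩ := Int.eq_ofNat_of_zero_le (hℓ.le.trans hqℓ)
  rw [hr] at hx_eq hrℓ
  rw [hq] at hx_eq hqℓ
  have hlow := sub_mul_le_of_neg_le_step
    (fun y hy hyb => (abs_le.1 (hstep y hy hyb)).1) r (by nlinarith)
  have hhigh := add_mul_le_of_le_window hℓ.le (Int.natCast_nonneg r)
    (fun y hy hyb => (hgrow y hy hyb).le) q (hx_eq.le.trans hxb)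
  rw [hx_eq] at hhigh
  nlinarith
end
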